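/- arXiv:1905.07594 — 2 statements merged into one kernel-verified Lean document; each statement's English description precedes it below -/
import Mathlib

section
/- Let 1 < p < 3. If real numbers u and v satisfy |u|^(p−1) + v² = |v|^(p−1) + u² and |u| ≠ |v|, then |u| ≤ 1 and |v| ≤ 1. In other words, the nontrivial part of the curve Λₚ = {(u,v) ∈ ℝ² : |u|^(p−1) + v² = |v|^(p−1) + u²}, namely the points with |u| ≠ |v|, is contained in the square [−1, 1] × [−1, 1]. -/
/-- For `0 < q < 2`, the values of `t ↦ t ^ 2 - t ^ q` on `(1, ∞)` exceed all earlier values. -/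
theorem sq_sub_rpow_lt_sq_sub_rpow {q a b : ℝ} (hq0 : 0 < q) (hq2 : q < 2)
    (hb : 0 ≤ b) (hba : b < a) (ha : 1 < a) : b ^ 2 - b ^ q < a ^ 2 - a ^ q := by
  rcases le_or_gt b 1 with hb1 | hb1
  · have h1 : b ^ (2 : ℝ) ≤ b ^ q := Real.rpow_le_rpow_of_exponent_ge' hb hb1 hq0.le hq2.le
    have h2 : a ^ q < a ^ (2 : ℝ) := Real.rpow_lt_rpow_of_exponent_lt ha hq2
    rw [Real.rpow_two] at h1 h2
    linarith
  · have factor : ∀ t : ℝ, 0 < t → t ^ 2 - t ^ q = t ^ q * (t ^ (2 - q) - 1) := by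
      intro t ht
      rw [mul_sub, ← Real.rpow_add ht, add_sub_cancel, Real.rpow_two, mul_one]
    rw [factor b (by linarith), factor a (by linarith)]
    have h1 : b ^ q < a ^ q := Real.rpow_lt_rpow hb hba hq0
    have h2 : b ^ (2 - q) < a ^ (2 - q) := Real.rpow_lt_rpow hb hba (by linarith)
    have h3 : 1 < b ^ (2 - q) := Real.one_lt_rpow hb1 (by linarith)
    exact mul_lt_mul'' h1 (by linarith) (Real.rpow_nonneg hb q) (by linarith)

theorem stmt_15 (p : ℝ) (hp1 : 1 < p) (hp3 : p < 3) (u v : ℝ)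
    (h : |u| ^ (p - 1) + v ^ 2 = |v| ^ (p - 1) + u ^ 2)
    (hne : |u| ≠ |v|) :
    |u| ≤ 1 ∧ |v| ≤ 1 := by
  have hq0 : 0 < p - 1 := by linarith
  have hq2 : p - 1 < 2 := by linarith
  rw [← sq_abs u, ← sq_abs v] at h
  rcases lt_or_gt_of_ne hne with huv | hvu
  · have hv : |v| ≤ 1 := by
      by_contra! hv
      linarith [sq_sub_rpow_lt_sq_sub_rpow hq0 hq2 (abs_nonneg u) huv hv]
    exact ⟨huv.le.trans hv, hv⟩
  · have hu : |u| ≤ 1 := by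
      by_contra! hu
      linarith [sq_sub_rpow_lt_sq_sub_rpow hq0 hq2 (abs_nonneg v) hvu hu]
    exact ⟨hu, hvu.le.trans hu⟩
end

section
/- Let 1 < p < 3 and ω > 1. Then the two curves Γ = {(u,v) ∈ ℝ² : |u|^(p−1) + v² = ω} and Γ* = {(u,v) ∈ ℝ² : |v|^(p−1) + u² = ω} intersect in exactly four points, namely B = (ℓ, ℓ), D = (ℓ, −ℓ), F = (−ℓ, −ℓ) and H = (−ℓ, ℓ), where ℓ is the unique positive real number satisfying ℓ^(p−1) + ℓ² = ω. In particular, every point (u,v) with |u|^(p−1) + v² = ω and |v|^(p−1) + u² = ω satisfies |u| = |v| = ℓ. -/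
open Set Filter Topology

/-- Log-concavity of `k ↦ b ^ k - a ^ k`, at the points `s`, `1`, `1 + s`: if the values at `s` and
`1` agree, then the value at `1 + s`, here divided by that at `1`, is at most `1`. -/
lemma rpow_add_le_one_of_rpow_sub_eq {s a b : ℝ} (hs0 : 0 < s) (hs1 : s < 1) (ha : 0 ≤ a)
    (hab : a < b) (h : b ^ s - a ^ s = b - a) : a ^ s + b ≤ 1 := by
  have hb : 0 < b := ha.trans_lt hab
  have hB : 0 < b ^ s := Real.rpow_pos_of_pos hb s
  have hA : 0 ≤ a ^ s := Real.rpow_nonneg ha s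
  have split : ∀ {x : ℝ}, 0 ≤ x → x = (x ^ s) ^ s * (x * x ^ s) ^ (1 - s) := by
    intro x hx
    rcases hx.eq_or_lt with rfl | hx
    · rw [zero_mul, Real.zero_rpow (by linarith : 1 - s ≠ 0), mul_zero]
    · have hX : 0 < x ^ s := Real.rpow_pos_of_pos hx s
      rw [Real.mul_rpow hx.le hX.le, mul_left_comm, ← Real.rpow_add hX, add_sub_cancel,
        Real.rpow_one, ← Real.rpow_add hx, sub_add_cancel, Real.rpow_one]
  have h1 : a / b ≤ s * (a ^ s / b ^ s) + (1 - s) * (a / b * (a ^ s / b ^ s)) := by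
    have := Real.geom_mean_le_arith_mean2_weighted hs0.le (sub_nonneg.2 hs1.le)
      (div_nonneg hA hB.le) (mul_nonneg (div_nonneg ha hb.le) (div_nonneg hA hB.le)) (by ring)
    rwa [← Real.div_rpow ha hb.le, ← split (div_nonneg ha hb.le), Real.div_rpow ha hb.le] at this
  have h2 : b⁻¹ ≤ s * (b ^ s)⁻¹ + (1 - s) * (b⁻¹ * (b ^ s)⁻¹) := by
    have := Real.geom_mean_le_arith_mean2_weighted hs0.le (sub_nonneg.2 hs1.le)
      (inv_nonneg.2 hB.le) (mul_nonneg (inv_nonneg.2 hb.le) (inv_nonneg.2 hB.le)) (by ring)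
    rwa [← Real.inv_rpow hb.le, ← split (inv_nonneg.2 hb.le), Real.inv_rpow hb.le] at this
  generalize a ^ s = A at *
  generalize b ^ s = B at *
  have h1' : a * B ≤ s * (A * b) + (1 - s) * (a * A) := by
    have := mul_le_mul_of_nonneg_right h1 (mul_pos hb hB).le
    field_simp at this
    linarith
  have h2' : B ≤ s * b + (1 - s) := by
    have := mul_le_mul_of_nonneg_right h2 (mul_pos hb hB).le
    field_simp at this
    linarith
  have h3 : (1 - s) * (b - a) * (A + b) ≤ (1 - s) * (b - a) * 1 := by
    have hBA : B = A + b - a := by linarith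
    have h4 := mul_le_mul_of_nonneg_left h2' (sub_nonneg.2 hab.le)
    subst hBA
    linarith
  exact le_of_mul_le_mul_left h3 (mul_pos (sub_pos.2 hs1) (sub_pos.2 hab))

lemma not_lt_of_rpow_add_sq_eq {r w x y : ℝ} (hr0 : 0 < r) (hr2 : r < 2) (hw : 1 < w)
    (hx : 0 ≤ x) (hy : 0 ≤ y) (h1 : x ^ r + y ^ 2 = w) (h2 : y ^ r + x ^ 2 = w) : ¬ x < y := by
  intro hxy
  have sq_rpow : ∀ {t : ℝ}, 0 ≤ t → (t ^ 2) ^ (r / 2) = t ^ r := by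
    intro t ht
    rw [← Real.rpow_natCast, ← Real.rpow_mul ht]
    congr 1
    push_cast
    ring
  have := rpow_add_le_one_of_rpow_sub_eq (s := r / 2) (by linarith) (by linarith) (sq_nonneg x)
    (pow_lt_pow_left₀ hxy hx two_ne_zero) (by rw [sq_rpow hx, sq_rpow hy]; linarith)
  rw [sq_rpow hx] at this
  linarith

lemma eq_of_rpow_add_sq_eq {r x y : ℝ} (hr : 0 < r) (hx : 0 ≤ x) (hy : 0 ≤ y)
    (h : x ^ r + x ^ 2 = y ^ r + y ^ 2) : x = y := by
  have mono : StrictMonoOn (fun t : ℝ => t ^ r + t ^ 2) (Ici 0) := fun a ha b _ hab =>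
    add_lt_add (Real.rpow_lt_rpow ha hab hr) (pow_lt_pow_left₀ hab ha two_ne_zero)
  exact mono.injOn hx hy h

theorem stmt_18 (p ω l : ℝ) (hp1 : 1 < p) (hp3 : p < 3) (hw : 1 < ω)
    (hl : 0 < l) (hleq : l ^ (p - 1) + l ^ 2 = ω) :
    ({q : ℝ × ℝ | |q.1| ^ (p - 1) + q.2 ^ 2 = ω} ∩
      {q : ℝ × ℝ | |q.2| ^ (p - 1) + q.1 ^ 2 = ω}
      = {(l, l), (l, -l), (-l, -l), (-l, l)}) ∧
    (∀ u v : ℝ, |u| ^ (p - 1) + v ^ 2 = ω → |v| ^ (p - 1) + u ^ 2 = ω →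
      |u| = l ∧ |v| = l) := by
  have key : ∀ u v : ℝ, |u| ^ (p - 1) + v ^ 2 = ω → |v| ^ (p - 1) + u ^ 2 = ω →
      |u| = l ∧ |v| = l := by
    intro u v h1 h2
    rw [← sq_abs] at h1 h2
    have hr0 : 0 < p - 1 := by linarith
    have hr2 : p - 1 < 2 := by linarith
    have huv : |u| = |v| := le_antisymm
      (not_lt.1 (not_lt_of_rpow_add_sq_eq hr0 hr2 hw (abs_nonneg v) (abs_nonneg u) h2 h1))
      (not_lt.1 (not_lt_of_rpow_add_sq_eq hr0 hr2 hw (abs_nonneg u) (abs_nonneg v) h1 h2))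
    have hvl : |v| = l :=
      eq_of_rpow_add_sq_eq hr0 (abs_nonneg v) hl.le (by rw [hleq, ← h1, huv])
    exact ⟨huv.trans hvl, hvl⟩
  refine ⟨?_, key⟩
  ext ⟨u, v⟩
  simp only [mem_inter_iff, mem_ofPred_eq, mem_insert_iff, mem_singleton_iff, Prod.mk.injEq]
  constructor
  · rintro ⟨h1, h2⟩
    obtain ⟨hu, hv⟩ := key u v h1 h2
    rcases (abs_eq hl.le).1 hu with hu | hu <;> rcases (abs_eq hl.le).1 hv with hv | hv <;>
      simp [hu, hv]
  · rintro (⟨rfl, rfl⟩ | ⟨rfl, rfl⟩ | ⟨rfl, rfl⟩ | ⟨rfl, rfl⟩) <;>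
      simp [abs_of_pos hl, hleq]
end
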